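/- Fix δ ∈ (0,1), N ≥ 2, n = N², and let y = θ* + ε be drawn from the Gaussian sequence model with θ* ∈ ℝ^{N×N}. Let θ↑ denote the Euclidean projection of θ* onto the closed convex cone M of bi-isotonic N×N matrices, and set D(θ↑) = (θ↑_{N,N} − θ↑_{1,1})². There exist absolute constants c, C > 0 such that the TV denoiser θ̂ on the 2D grid with tuning parameter λ = c·σ·√((log n)·log(en/δ))/n satisfies, with probability at least 1 − 2δ: (1/n)‖θ̂ − θ*‖₂² ≤ (1/n)‖θ↑ − θ*‖₂² + C·σ·√( (log n)·log(n/δ) / n )·√(D(θ↑)) + C·(σ²/n)·log(e/δ). -/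

import Mathlib

open MeasureTheory ProbabilityTheory Matrix

noncomputable section

/-- Euclidean norm of a finitely indexed real vector. -/
def norm2 {V : Type*} [Fintype V] (θ : V → ℝ) : ℝ := Real.sqrt (∑ i, θ i ^ 2)

/-- Euclidean norm of the `j`-th column of `S`. -/
def colNorm {V E : Type*} [Fintype V] (S : Matrix V E ℝ) (j : E) : ℝ :=
  Real.sqrt (∑ i, S i j ^ 2)

/-- `D` is an (oriented) edge–vertex incidence matrix of the simple graph `G`:
each row has a `1` and a `-1` at the endpoints of an edge of `G` and `0` elsewhere,
and each edge of `G` corresponds to exactly one row. -/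
def IsIncidence {V E : Type*} (G : SimpleGraph V) (D : Matrix E V ℝ) : Prop :=
  (∀ e : E, ∃ i j : V, G.Adj i j ∧ D e i = 1 ∧ D e j = -1 ∧
      ∀ k : V, k ≠ i → k ≠ j → D e k = 0) ∧
  (∀ i j : V, G.Adj i j →
      ∃! e : E, (D e i = 1 ∧ D e j = -1) ∨ (D e i = -1 ∧ D e j = 1))

/-- `S` is the Moore–Penrose pseudoinverse of `D`. -/
def IsMoorePenrose {E V : Type*} [Fintype V] [Fintype E]
    (D : Matrix E V ℝ) (S : Matrix V E ℝ) : Prop :=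
  D * S * D = D ∧ S * D * S = S ∧ (D * S)ᵀ = D * S ∧ (S * D)ᵀ = S * D

/-- Inverse scaling factor: maximal column norm of the pseudoinverse `S` of `D`. -/
def invScaling {V E : Type*} [Fintype V] (S : Matrix V E ℝ) : ℝ := ⨆ j : E, colNorm S j

/-- Compatibility factor `κ_T(D)`. -/
def compat {V E : Type*} [Fintype V] [Fintype E] [DecidableEq E]
    (D : Matrix E V ℝ) (T : Finset E) : ℝ :=
  if T = ∅ then 1
  else sInf {r : ℝ | ∃ θ : V → ℝ, (∑ e ∈ T, |D.mulVec θ e|) ≠ 0 ∧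
    r = Real.sqrt T.card * norm2 θ / ∑ e ∈ T, |D.mulVec θ e|}

/-- `θhat` is a TV denoiser with data `y` and regularization `lam`,
i.e. a minimizer of the TV-penalized least squares criterion. -/
def IsTVDenoiser {V E : Type*} [Fintype V] [Fintype E]
    (D : Matrix E V ℝ) (lam : ℝ) (y θhat : V → ℝ) : Prop :=
  ∀ θ : V → ℝ,
    (1 / (Fintype.card V : ℝ)) * ∑ i, (θhat i - y i) ^ 2 + lam * ∑ e, |D.mulVec θhat e|
      ≤ (1 / (Fintype.card V : ℝ)) * ∑ i, (θ i - y i) ^ 2 + lam * ∑ e, |D.mulVec θ e|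

/-- The law of the noise vector `ε`: independent centered Gaussian coordinates
with variance `σ²`. -/
def noise (V : Type*) [Fintype V] (σ : ℝ) : Measure (V → ℝ) :=
  Measure.pi fun _ => gaussianReal 0 (σ ^ 2).toNNReal

/-- Number of nonzero coordinates. -/
def supp0 {E : Type*} [Fintype E] (x : E → ℝ) : ℕ :=
  (Finset.univ.filter fun e => x e ≠ 0).card

/-- The N×N two-dimensional grid graph. -/
def gridGraph2 (N : ℕ) : SimpleGraph (Fin N × Fin N) :=
  SimpleGraph.fromRel fun a b =>
    (a.1 = b.1 ∧ (a.2 : ℕ) + 1 = (b.2 : ℕ)) ∨ (a.2 = b.2 ∧ (a.1 : ℕ) + 1 = (b.1 : ℕ))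

/-- The d-dimensional N×⋯×N grid graph. -/
def gridGraphD (d N : ℕ) : SimpleGraph (Fin d → Fin N) :=
  SimpleGraph.fromRel fun a b =>
    ∃ j : Fin d, ((a j : ℕ) + 1 = (b j : ℕ)) ∧ ∀ k : Fin d, k ≠ j → a k = b k

/-- The d-dimensional hypercube graph. -/
def cubeGraph (d : ℕ) : SimpleGraph (Fin d → Bool) :=
  SimpleGraph.fromRel fun a b =>
    ∃ j : Fin d, a j ≠ b j ∧ ∀ k : Fin d, k ≠ j → a k = b k

/-- The k-th power of the cycle graph on n vertices. -/
def cyclePowerGraph (n k : ℕ) : SimpleGraph (Fin n) :=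
  SimpleGraph.fromRel fun a b =>
    ∃ l : ℕ, 1 ≤ l ∧ l ≤ k ∧ (b : ℕ) = ((a : ℕ) + l) % n

/-- The closed convex cone of bi-isotonic N×N matrices. -/
def biIso (N : ℕ) : Set (Fin N × Fin N → ℝ) :=
  {θ | ∀ i j : Fin N × Fin N, i.1 ≤ j.1 → i.2 ≤ j.2 → θ i ≤ θ j}


/-- A linear functional of the noise has Gaussian tails. -/
lemma noise_linear_tail {V : Type*} [Fintype V] (σ : ℝ) (a : V → ℝ) {K t : ℝ} (hK : 0 < K)
    (ha : σ ^ 2 * ∑ i, a i ^ 2 ≤ K) (ht : 0 ≤ t) :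
    noise V σ {ε | t ≤ |∑ i, a i * ε i|} ≤ ENNReal.ofReal (2 * Real.exp (-t ^ 2 / (2 * K))) := by
  have hprob : IsProbabilityMeasure (noise V σ) := by unfold noise; infer_instance
  set v : NNReal := (σ ^ 2).toNNReal with hv
  have hid : HasSubgaussianMGF id v (gaussianReal 0 v) :=
    ⟨fun s => integrable_exp_mul_gaussianReal s, fun s => by
      rw [mgf_id_gaussianReal]; simp⟩
  have hcoord : ∀ i, HasSubgaussianMGF (fun ε : V → ℝ => a i * ε i)
      (.mk (a i ^ 2) (sq_nonneg _) * v) (noise V σ) := by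
    intro i
    have hev : HasSubgaussianMGF (id ∘ fun ε : V → ℝ => ε i) v (noise V σ) := by
      refine HasSubgaussianMGF.of_map (measurable_pi_apply i).aemeasurable ?_
      have := (measurePreserving_eval (fun _ : V => gaussianReal 0 v) i).map_eq
      unfold noise
      rw [← hv]
      rw [show (fun ε : V → ℝ => ε i) = Function.eval i from rfl, this]
      exact hid
    exact hev.const_mul (a i)
  have hind : iIndepFun (fun i (ε : V → ℝ) => a i * ε i) (noise V σ) :=
    iIndepFun_pi (μ := fun _ : V => gaussianReal 0 v) (X := fun i x => a i * x)
      fun i => by fun_prop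
  have hsum : HasSubgaussianMGF (fun ε : V → ℝ => ∑ i, a i * ε i)
      (∑ i, .mk (a i ^ 2) (sq_nonneg _) * v) (noise V σ) :=
    HasSubgaussianMGF.sum_of_iIndepFun hind fun i _ => hcoord i
  have hc : ((∑ i, (.mk (a i ^ 2) (sq_nonneg _) * v : NNReal) : NNReal) : ℝ) ≤ K := by
    push_cast
    rw [← Finset.sum_mul, hv, Real.coe_toNNReal _ (sq_nonneg _), mul_comm]
    exact ha
  have hsum' : HasSubgaussianMGF (fun ε : V → ℝ => ∑ i, a i * ε i) (.mk K hK.le) (noise V σ) :=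
    ⟨hsum.integrable_exp_mul, fun s => (hsum.mgf_le s).trans <| by
      apply Real.exp_le_exp.2
      simp only [NNReal.coe_mk]
      gcongr⟩
  have h1 := hsum'.measure_ge_le ht
  have h2 := hsum'.neg.measure_ge_le ht
  simp only [NNReal.coe_mk, Pi.neg_apply] at h1 h2
  have hsub : {ε : V → ℝ | t ≤ |∑ i, a i * ε i|} ⊆
      {ε | t ≤ ∑ i, a i * ε i} ∪ {ε | t ≤ -∑ i, a i * ε i} := fun ε hε => by
    simpa [le_abs] using hε
  rw [← ofReal_measureReal]
  apply ENNReal.ofReal_le_ofReal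
  calc _ ≤ _ := measureReal_mono hsub
    _ ≤ _ := measureReal_union_le _ _
    _ ≤ _ := by linarith

/-- The `k`-th orthonormal discrete cosine mode on `N` points. -/
def cosMode (N k a : ℕ) : ℝ :=
  Real.sqrt ((if k = 0 then 1 else 2) / N) * Real.cos (Real.pi * k * (a + 1 / 2) / N)

lemma sum_cos_half_eq_zero {N p : ℕ} (hp : 0 < p) (hpN : p < 2 * N) :
    ∑ a ∈ Finset.range N, Real.cos (Real.pi * p * (a + 1 / 2) / N) = 0 := by
  have hN : (0 : ℝ) < N := by
    have : 0 < N := by omega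
    exact_mod_cast this
  have hp' : (0 : ℝ) < p := by exact_mod_cast hp
  have hpN' : (p : ℝ) < 2 * N := by exact_mod_cast hpN
  have hs : 0 < Real.sin (Real.pi * p / (2 * N)) := by
    apply Real.sin_pos_of_pos_of_lt_pi
    · positivity
    · rw [div_lt_iff₀ (by positivity)]
      exact mul_lt_mul_of_pos_left hpN' Real.pi_pos
  have key : ∀ a : ℕ, 2 * Real.sin (Real.pi * p / (2 * N)) *
      Real.cos (Real.pi * p * (a + 1 / 2) / N) =
      Real.sin (Real.pi * p * ((a + 1 : ℕ) : ℝ) / N) - Real.sin (Real.pi * p * (a : ℝ) / N) := by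
    intro a
    rw [Real.sin_sub_sin,
      show (Real.pi * p * ((a + 1 : ℕ) : ℝ) / N - Real.pi * p * (a : ℝ) / N) / 2 =
        Real.pi * p / (2 * N) by push_cast; ring,
      show (Real.pi * p * ((a + 1 : ℕ) : ℝ) / N + Real.pi * p * (a : ℝ) / N) / 2 =
        Real.pi * p * (a + 1 / 2) / N by push_cast; ring]
  have hsum : 2 * Real.sin (Real.pi * p / (2 * N)) *
      ∑ a ∈ Finset.range N, Real.cos (Real.pi * p * (a + 1 / 2) / N) = 0 := by
    rw [Finset.mul_sum, Finset.sum_congr rfl fun a _ => key a,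
      Finset.sum_range_sub (fun a : ℕ => Real.sin (Real.pi * p * (a : ℝ) / N))]
    rw [mul_div_assoc, div_self hN.ne', mul_one, mul_comm, Real.sin_nat_mul_pi]
    simp
  rcases mul_eq_zero.1 hsum with h | h
  · linarith
  · exact h

lemma sum_cos_mul_cos {N k l : ℕ} (hk : k < N) (hl : l < N) (hkl : l ≤ k) :
    ∑ a ∈ Finset.range N, Real.cos (Real.pi * k * (a + 1 / 2) / N) *
      Real.cos (Real.pi * l * (a + 1 / 2) / N) =
      if k = l then (if k = 0 then (N : ℝ) else N / 2) else 0 := by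
  have key : ∀ a : ℕ, Real.cos (Real.pi * k * (a + 1 / 2) / N) *
      Real.cos (Real.pi * l * (a + 1 / 2) / N) =
      (Real.cos (Real.pi * (k - l : ℕ) * (a + 1 / 2) / N) +
        Real.cos (Real.pi * (k + l : ℕ) * (a + 1 / 2) / N)) / 2 := by
    intro a
    have h1 : Real.pi * (k - l : ℕ) * (a + 1 / 2) / N =
        Real.pi * k * (a + 1 / 2) / N - Real.pi * l * (a + 1 / 2) / N := by
      push_cast [Nat.cast_sub hkl]; ring
    have h2 : Real.pi * (k + l : ℕ) * (a + 1 / 2) / N =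
        Real.pi * k * (a + 1 / 2) / N + Real.pi * l * (a + 1 / 2) / N := by
      push_cast; ring
    rw [h1, h2, Real.cos_sub, Real.cos_add]
    ring
  rw [Finset.sum_congr rfl fun a _ => key a, ← Finset.sum_div, Finset.sum_add_distrib]
  split_ifs with h h0
  · subst h h0
    simp
  · subst h
    rw [sum_cos_half_eq_zero (p := k + k) (by omega) (by omega)]
    simp
  · rw [sum_cos_half_eq_zero (p := k - l) (by omega) (by omega),
      sum_cos_half_eq_zero (p := k + l) (by omega) (by omega)]
    simp

lemma cosMode_inner {N : ℕ} (k l : Fin N) :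
    ∑ a : Fin N, cosMode N k a * cosMode N l a = if k = l then 1 else 0 := by
  wlog hkl : l ≤ k with H
  · simp_rw [mul_comm (cosMode N k _)]
    rw [H l k (le_of_not_ge hkl)]
    simp [eq_comm]
  have hN : (0 : ℝ) < N := by
    have : 0 < N := k.pos
    exact_mod_cast this
  rw [Fin.sum_univ_eq_sum_range (fun a => cosMode N k a * cosMode N l a) N]
  simp only [cosMode]
  rw [Finset.sum_congr rfl fun a _ => mul_mul_mul_comm _ _ _ _, ← Finset.mul_sum,
    sum_cos_mul_cos k.2 l.2 hkl]
  by_cases h : k = l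
  · subst h
    rw [Real.mul_self_sqrt (by positivity)]
    by_cases h0 : (k : ℕ) = 0
    · simp [h0, hN.ne']
    · simp only [h0, if_true, if_false]
      field_simp
  · simp [h, Fin.val_inj]

lemma cosMode_complete {N : ℕ} (a b : Fin N) :
    ∑ k : Fin N, cosMode N k a * cosMode N k b = if a = b then 1 else 0 := by
  have h : (Matrix.of fun k a : Fin N => cosMode N k a) *
      (Matrix.of fun k a : Fin N => cosMode N k a)ᵀ = 1 := by
    ext k l
    simp [Matrix.mul_apply, Matrix.one_apply, cosMode_inner]
  have h' := congrFun (congrFun (mul_eq_one_comm.1 h :) a) b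
  simpa [Matrix.mul_apply, Matrix.one_apply] using h'

/-- The right neighbour on the path `0, …, N - 1`, with the last point sent to itself. -/
def pathNext {N : ℕ} (a : Fin N) : Fin N := if h : (a : ℕ) + 1 < N then ⟨a + 1, h⟩ else a

/-- The discrete derivative of `cosMode N k` between `a - 1` and `a`. -/
def cosModeDeriv (N k a : ℕ) : ℝ :=
  -(Real.sqrt ((if k = 0 then 1 else 2) / N) * (2 * Real.sin (Real.pi * k * a / N) *
    Real.sin (Real.pi * k / (2 * N))))

/-- The `k`-th eigenvalue of the Laplacian of the path on `N` points. -/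
def pathEigenvalue (N k : ℕ) : ℝ := 4 * Real.sin (Real.pi * k / (2 * N)) ^ 2

lemma cosModeDeriv_zero (N k : ℕ) : cosModeDeriv N k 0 = 0 := by simp [cosModeDeriv]

lemma cosModeDeriv_last {N : ℕ} (hN : 0 < N) (k : ℕ) : cosModeDeriv N k N = 0 := by
  have hN' : (N : ℝ) ≠ 0 := by exact_mod_cast hN.ne'
  rw [cosModeDeriv, mul_div_assoc, div_self hN', mul_one, mul_comm Real.pi, Real.sin_nat_mul_pi]
  simp

lemma cosModeDeriv_succ (N k a : ℕ) :
    cosModeDeriv N k (a + 1) = cosMode N k (a + 1) - cosMode N k a := by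
  rw [cosModeDeriv, cosMode, cosMode, ← mul_sub, Real.cos_sub_cos,
    show (Real.pi * k * (((a + 1 : ℕ) : ℝ) + 1 / 2) / N + Real.pi * k * ((a : ℝ) + 1 / 2) / N) / 2 =
      Real.pi * k * ((a + 1 : ℕ) : ℝ) / N by push_cast; ring,
    show (Real.pi * k * (((a + 1 : ℕ) : ℝ) + 1 / 2) / N - Real.pi * k * ((a : ℝ) + 1 / 2) / N) / 2 =
      Real.pi * k / (2 * N) by push_cast; ring]
  ring

lemma cosMode_pathNext_sub {N : ℕ} (k : ℕ) (a : Fin N) :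
    cosMode N k (pathNext a) - cosMode N k a = cosModeDeriv N k (a + 1) := by
  unfold pathNext
  split_ifs with h
  · rw [cosModeDeriv_succ]
  · rw [show (a : ℕ) + 1 = N by omega, cosModeDeriv_last a.pos, sub_self]

lemma cosModeDeriv_sub (N k a : ℕ) :
    cosModeDeriv N k a - cosModeDeriv N k (a + 1) = pathEigenvalue N k * cosMode N k a := by
  have h : Real.sin (Real.pi * k * ((a + 1 : ℕ) : ℝ) / N) - Real.sin (Real.pi * k * a / N) =
      2 * Real.sin (Real.pi * k / (2 * N)) * Real.cos (Real.pi * k * (a + 1 / 2) / N) := by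
    rw [Real.sin_sub_sin,
      show (Real.pi * k * ((a + 1 : ℕ) : ℝ) / N - Real.pi * k * (a : ℝ) / N) / 2 =
        Real.pi * k / (2 * N) by push_cast; ring,
      show (Real.pi * k * ((a + 1 : ℕ) : ℝ) / N + Real.pi * k * (a : ℝ) / N) / 2 =
        Real.pi * k * (a + 1 / 2) / N by push_cast; ring]
  rw [cosModeDeriv, cosModeDeriv, pathEigenvalue, cosMode]
  linear_combination (2 * Real.sqrt ((if k = 0 then 1 else 2) / N) *
    Real.sin (Real.pi * k / (2 * N))) * h

/-- Summation by parts: `cosMode N k` is an eigenvector of the path Laplacian. -/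
lemma cosMode_laplacian {N : ℕ} (hN : 0 < N) (k : ℕ) (f : Fin N → ℝ) :
    ∑ a : Fin N, (cosMode N k (pathNext a) - cosMode N k a) * (f (pathNext a) - f a) =
      pathEigenvalue N k * ∑ a : Fin N, cosMode N k a * f a := by
  set g : ℕ → ℝ := fun a => if h : a < N then f ⟨a, h⟩ else 0 with hg
  have hfg : ∀ a : Fin N, f a = g a := fun a => by simp [hg]
  have h1 : ∀ a : Fin N, (cosMode N k (pathNext a) - cosMode N k a) * (f (pathNext a) - f a) =
      cosModeDeriv N k (a + 1) * (g (a + 1) - g a) := by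
    intro a
    rw [cosMode_pathNext_sub]
    by_cases h : (a : ℕ) + 1 < N
    · rw [hfg, hfg]
      simp [pathNext, h]
    · rw [show (a : ℕ) + 1 = N by omega, cosModeDeriv_last hN]
      simp
  rw [Finset.sum_congr rfl fun a _ => h1 a,
    Finset.sum_congr rfl fun (a : Fin N) _ => congrArg (cosMode N k a * ·) (hfg a),
    Fin.sum_univ_eq_sum_range (fun a => cosModeDeriv N k (a + 1) * (g (a + 1) - g a)),
    Fin.sum_univ_eq_sum_range (fun a => cosMode N k a * g a)]
  have h2 : ∀ a : ℕ, cosModeDeriv N k (a + 1) * (g (a + 1) - g a) =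
      (cosModeDeriv N k (a + 1) * g (a + 1) - cosModeDeriv N k a * g a) +
        pathEigenvalue N k * (cosMode N k a * g a) := by
    intro a
    rw [← mul_assoc, ← cosModeDeriv_sub]
    ring
  rw [Finset.sum_congr rfl fun a _ => h2 a, Finset.sum_add_distrib, ← Finset.mul_sum,
    Finset.sum_range_sub (fun a => cosModeDeriv N k a * g a), cosModeDeriv_zero,
    cosModeDeriv_last hN]
  ring

lemma cosMode_sq_le {N : ℕ} (k a : ℕ) : cosMode N k a ^ 2 ≤ 2 / N := by
  rw [cosMode, mul_pow, Real.sq_sqrt (by positivity)]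
  calc _ ≤ (2 / N : ℝ) * 1 := by
        gcongr
        · split_ifs <;> norm_num
        · exact Real.cos_sq_le_one _
    _ = _ := mul_one _

lemma cosModeDeriv_sq_le {N : ℕ} (k a : ℕ) :
    cosModeDeriv N k a ^ 2 ≤ 2 / N * pathEigenvalue N k := by
  rw [cosModeDeriv, pathEigenvalue, neg_sq, mul_pow, Real.sq_sqrt (by positivity)]
  gcongr
  · split_ifs <;> norm_num
  · rw [mul_pow, mul_pow]
    nlinarith [Real.sin_sq_le_one (Real.pi * k * a / N),
      sq_nonneg (Real.sin (Real.pi * k / (2 * N)))]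

lemma pathEigenvalue_ge {N k : ℕ} (hk : k < N) :
    4 / (N : ℝ) ^ 2 * (k : ℝ) ^ 2 ≤ pathEigenvalue N k := by
  have hN : (0 : ℝ) < N := by
    have : 0 < N := by omega
    exact_mod_cast this
  have hk' : (k : ℝ) ≤ N := by exact_mod_cast hk.le
  have h : (k / N : ℝ) ≤ Real.sin (Real.pi * k / (2 * N)) := by
    refine le_trans (le_of_eq ?_) (Real.mul_le_sin (x := Real.pi * k / (2 * N)) (by positivity) ?_)
    · field_simp
    · rw [div_le_div_iff₀ (by positivity) (by positivity)]
      nlinarith [Real.pi_pos]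
  rw [pathEigenvalue]
  have := pow_le_pow_left₀ (by positivity) h 2
  calc _ = 4 * (k / N : ℝ) ^ 2 := by ring
    _ ≤ _ := by linarith

lemma sum_inv_sq_add_sq_le (N : ℕ) :
    ∑ i ∈ Finset.range (N + 1), ∑ j ∈ Finset.range (N + 1), (((i : ℝ) ^ 2 + (j : ℝ) ^ 2))⁻¹ ≤
      3 * (harmonic N : ℝ) := by
  induction N with
  | zero => simp
  | succ n ih =>
    have hrow : ∑ j ∈ Finset.range (n + 1), ((((n + 1 : ℕ) : ℝ) ^ 2 + (j : ℝ) ^ 2))⁻¹ ≤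
        ((n + 1 : ℕ) : ℝ)⁻¹ := by
      calc _ ≤ ∑ j ∈ Finset.range (n + 1), (((n + 1 : ℕ) : ℝ) ^ 2)⁻¹ := by
            refine Finset.sum_le_sum fun j _ => ?_
            gcongr
            nlinarith [sq_nonneg (j : ℝ)]
        _ = _ := by
            rw [Finset.sum_const, Finset.card_range, nsmul_eq_mul]
            field_simp
    have hcol : ∑ i ∈ Finset.range (n + 1), (((i : ℝ) ^ 2 + ((n + 1 : ℕ) : ℝ) ^ 2))⁻¹ ≤
        ((n + 1 : ℕ) : ℝ)⁻¹ := by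
      rw [Finset.sum_congr rfl fun i _ => by rw [add_comm]]
      exact hrow
    have hcorner : ((((n + 1 : ℕ) : ℝ) ^ 2 + ((n + 1 : ℕ) : ℝ) ^ 2))⁻¹ ≤
        ((n + 1 : ℕ) : ℝ)⁻¹ := by
      gcongr
      have : (1 : ℝ) ≤ ((n + 1 : ℕ) : ℝ) := by exact_mod_cast Nat.succ_le_succ n.zero_le
      nlinarith
    rw [harmonic_succ, Finset.sum_range_succ,
      Finset.sum_congr rfl fun i _ => Finset.sum_range_succ _ (n + 1), Finset.sum_add_distrib,
      Finset.sum_range_succ (fun j : ℕ => (((((n + 1 : ℕ) : ℝ) ^ 2 + (j : ℝ) ^ 2))⁻¹)) (n + 1)]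
    push_cast at *
    linarith

/-- The neighbour of a grid point in the first (`true`) or second (`false`) direction; boundary
points are sent to themselves. -/
def gridStep {N : ℕ} : Bool → Fin N × Fin N → Fin N × Fin N
  | true, v => (pathNext v.1, v.2)
  | false, v => (v.1, pathNext v.2)

/-- Forward differences of a matrix in both directions. -/
def gridDiff {N : ℕ} (h : Fin N × Fin N → ℝ) (q : Bool × (Fin N × Fin N)) : ℝ :=
  h (gridStep q.1 q.2) - h q.2

/-- The orthonormal eigenvectors of the grid Laplacian. -/
def gridMode (N : ℕ) (k v : Fin N × Fin N) : ℝ := cosMode N k.1 v.1 * cosMode N k.2 v.2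

/-- The eigenvalues of the grid Laplacian. -/
def gridEigenvalue (N : ℕ) (k : Fin N × Fin N) : ℝ := pathEigenvalue N k.1 + pathEigenvalue N k.2

lemma gridMode_inner {N : ℕ} (k l : Fin N × Fin N) :
    ∑ v, gridMode N k v * gridMode N l v = if k = l then 1 else 0 := by
  simp only [gridMode, mul_mul_mul_comm]
  rw [Fintype.sum_prod_type, ← Fintype.sum_mul_sum
    (fun a : Fin N => cosMode N k.1 a * cosMode N l.1 a)
    (fun b : Fin N => cosMode N k.2 b * cosMode N l.2 b), cosMode_inner, cosMode_inner]
  simp [Prod.ext_iff, ← ite_and, and_comm]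

lemma gridMode_complete {N : ℕ} (v w : Fin N × Fin N) :
    ∑ k, gridMode N k v * gridMode N k w = if v = w then 1 else 0 := by
  simp only [gridMode, mul_mul_mul_comm]
  rw [Fintype.sum_prod_type, ← Fintype.sum_mul_sum
    (fun k : Fin N => cosMode N k v.1 * cosMode N k w.1)
    (fun k : Fin N => cosMode N k v.2 * cosMode N k w.2), cosMode_complete, cosMode_complete]
  simp [Prod.ext_iff, ← ite_and, and_comm]

lemma gridMode_expansion {N : ℕ} (f : Fin N × Fin N → ℝ) (v : Fin N × Fin N) :
    f v = ∑ k, gridMode N k v * ∑ w, gridMode N k w * f w := by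
  simp_rw [Finset.mul_sum, ← mul_assoc]
  rw [Finset.sum_comm]
  simp_rw [← Finset.sum_mul, gridMode_complete]
  simp

lemma gridMode_parseval {N : ℕ} (c : Fin N × Fin N → ℝ) :
    ∑ v, (∑ k, c k * gridMode N k v) ^ 2 = ∑ k, c k ^ 2 := by
  simp_rw [sq, Finset.sum_mul_sum]
  rw [Finset.sum_comm]
  refine Finset.sum_congr rfl fun k _ => ?_
  rw [Finset.sum_comm]
  simp_rw [mul_mul_mul_comm (c k), ← Finset.mul_sum, gridMode_inner]
  simp

lemma gridMode_laplacian {N : ℕ} (k : Fin N × Fin N) (f : Fin N × Fin N → ℝ) :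
    ∑ q, gridDiff (gridMode N k) q * gridDiff f q =
      gridEigenvalue N k * ∑ v, gridMode N k v * f v := by
  have hN : 0 < N := k.1.pos
  rw [Fintype.sum_prod_type, Fintype.sum_bool, gridEigenvalue, add_mul]
  congr 1
  · rw [Fintype.sum_prod_type_right, Fintype.sum_prod_type_right, Finset.mul_sum]
    refine Finset.sum_congr rfl fun b _ => ?_
    have h := cosMode_laplacian hN k.1 fun a => f (a, b)
    simp only [gridDiff, gridStep, gridMode]
    calc _ = cosMode N k.2 b * ∑ a : Fin N, (cosMode N k.1 (pathNext a) - cosMode N k.1 a) *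
          (f (pathNext a, b) - f (a, b)) := by
          rw [Finset.mul_sum]
          exact Finset.sum_congr rfl fun a _ => by ring
      _ = _ := by
          rw [h, mul_left_comm, Finset.mul_sum]
          congr 1
          exact Finset.sum_congr rfl fun a _ => by ring
  · rw [Fintype.sum_prod_type, Fintype.sum_prod_type, Finset.mul_sum]
    refine Finset.sum_congr rfl fun a _ => ?_
    have h := cosMode_laplacian hN k.2 fun b => f (a, b)
    simp only [gridDiff, gridStep, gridMode]
    calc _ = cosMode N k.1 a * ∑ b : Fin N, (cosMode N k.2 (pathNext b) - cosMode N k.2 b) *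
          (f (a, pathNext b) - f (a, b)) := by
          rw [Finset.mul_sum]
          exact Finset.sum_congr rfl fun b _ => by ring
      _ = _ := by
          rw [h, mul_left_comm, Finset.mul_sum]
          congr 1
          exact Finset.sum_congr rfl fun b _ => by ring

lemma pathEigenvalue_nonneg (N k : ℕ) : 0 ≤ pathEigenvalue N k := by
  unfold pathEigenvalue; positivity

lemma gridDiff_gridMode_sq_le {N : ℕ} (k : Fin N × Fin N) (q : Bool × (Fin N × Fin N)) :
    gridDiff (gridMode N k) q ^ 2 ≤ 4 / (N : ℝ) ^ 2 * gridEigenvalue N k := by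
  have h1 := pathEigenvalue_nonneg N k.1
  have h2 := pathEigenvalue_nonneg N k.2
  obtain ⟨d, a, b⟩ := q
  cases d
  · simp only [gridDiff, gridStep, gridMode, gridEigenvalue]
    rw [← mul_sub, cosMode_pathNext_sub, mul_pow]
    calc _ ≤ 2 / N * (2 / N * pathEigenvalue N k.2) :=
          mul_le_mul (cosMode_sq_le _ _) (cosModeDeriv_sq_le _ _) (sq_nonneg _) (by positivity)
      _ = 4 / (N : ℝ) ^ 2 * pathEigenvalue N k.2 := by ring
      _ ≤ _ := by gcongr; linarith
  · simp only [gridDiff, gridStep, gridMode, gridEigenvalue]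
    rw [← sub_mul, cosMode_pathNext_sub, mul_pow]
    calc _ ≤ 2 / N * pathEigenvalue N k.1 * (2 / N) :=
          mul_le_mul (cosModeDeriv_sq_le _ _) (cosMode_sq_le _ _) (sq_nonneg _) (by positivity)
      _ = 4 / (N : ℝ) ^ 2 * pathEigenvalue N k.1 := by ring
      _ ≤ _ := by gcongr; linarith

/-- The pseudoinverse of the difference operator `gridDiff`. -/
def gridFlow (N : ℕ) (q : Bool × (Fin N × Fin N)) (v : Fin N × Fin N) : ℝ :=
  ∑ k, (gridEigenvalue N k)⁻¹ * gridDiff (gridMode N k) q * gridMode N k v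

lemma gridEigenvalue_ge {N : ℕ} (k : Fin N × Fin N) :
    4 / (N : ℝ) ^ 2 * (((k.1 : ℕ) : ℝ) ^ 2 + ((k.2 : ℕ) : ℝ) ^ 2) ≤ gridEigenvalue N k := by
  rw [mul_add]
  exact add_le_add (pathEigenvalue_ge k.1.2) (pathEigenvalue_ge k.2.2)

lemma gridEigenvalue_zero (N : ℕ) [NeZero N] : gridEigenvalue N 0 = 0 := by
  simp [gridEigenvalue, pathEigenvalue]

lemma normSq_index_pos {N : ℕ} [NeZero N] {k : Fin N × Fin N} (hk : k ≠ 0) :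
    0 < ((k.1 : ℕ) : ℝ) ^ 2 + ((k.2 : ℕ) : ℝ) ^ 2 := by
  have : (k.1 : ℕ) ≠ 0 ∨ (k.2 : ℕ) ≠ 0 := by
    by_contra! h
    exact hk (Prod.ext (Fin.ext (by simpa using h.1)) (Fin.ext (by simpa using h.2)))
  rcases this with h | h
  · have : ((k.1 : ℕ) : ℝ) ≠ 0 := by exact_mod_cast h
    positivity
  · have : ((k.2 : ℕ) : ℝ) ≠ 0 := by exact_mod_cast h
    positivity

lemma gridEigenvalue_pos {N : ℕ} [NeZero N] {k : Fin N × Fin N} (hk : k ≠ 0) :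
    0 < gridEigenvalue N k := by
  have hN : (0 : ℝ) < N := by exact_mod_cast k.1.pos
  refine lt_of_lt_of_le ?_ (gridEigenvalue_ge k)
  have := normSq_index_pos hk
  positivity

/-- The inverse scaling factor of the two-dimensional grid is at most logarithmic. -/
lemma sum_gridFlow_sq_le {N : ℕ} (hN : 2 ≤ N) (q : Bool × (Fin N × Fin N)) :
    ∑ v, gridFlow N q v ^ 2 ≤ 4 * Real.log ((N : ℝ) ^ 2) := by
  have : NeZero N := ⟨by omega⟩
  have hN' : (2 : ℝ) ≤ N := by exact_mod_cast hN
  have hterm : ∀ k : Fin N × Fin N,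
      ((gridEigenvalue N k)⁻¹ * gridDiff (gridMode N k) q) ^ 2 ≤
        (((k.1 : ℕ) : ℝ) ^ 2 + ((k.2 : ℕ) : ℝ) ^ 2)⁻¹ := by
    intro k
    by_cases hk : k = 0
    · subst hk
      simp [gridEigenvalue_zero]
    have hpos := gridEigenvalue_pos hk
    have hpos' := normSq_index_pos hk
    calc _ = (gridEigenvalue N k)⁻¹ ^ 2 * gridDiff (gridMode N k) q ^ 2 := mul_pow _ _ _
      _ ≤ (gridEigenvalue N k)⁻¹ ^ 2 * (4 / (N : ℝ) ^ 2 * gridEigenvalue N k) := by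
          gcongr
          exact gridDiff_gridMode_sq_le k q
      _ = 4 / (N : ℝ) ^ 2 * (gridEigenvalue N k)⁻¹ := by field_simp
      _ ≤ 4 / (N : ℝ) ^ 2 *
          (4 / (N : ℝ) ^ 2 * (((k.1 : ℕ) : ℝ) ^ 2 + ((k.2 : ℕ) : ℝ) ^ 2))⁻¹ := by
          gcongr
          exact gridEigenvalue_ge k
      _ = _ := by field_simp
  unfold gridFlow
  rw [gridMode_parseval]
  have hlog : Real.log ((N : ℝ) ^ 2) = 2 * Real.log N := by
    rw [Real.log_pow]; norm_num
  have hlog2 : 0.69 ≤ Real.log N := by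
    have := Real.log_two_gt_d9
    have := Real.log_le_log (by norm_num) hN'
    linarith
  have hpred : ((N - 1 : ℕ) : ℝ) ≤ N := by exact_mod_cast Nat.sub_le N 1
  have hlog' : Real.log ((N - 1 : ℕ) : ℝ) ≤ Real.log N := by
    refine Real.log_le_log ?_ hpred
    have : 0 < N - 1 := by omega
    exact_mod_cast this
  have hharm := harmonic_le_one_add_log (N - 1)
  have hsum := sum_inv_sq_add_sq_le (N - 1)
  rw [show N - 1 + 1 = N by omega] at hsum
  calc _ ≤ ∑ k : Fin N × Fin N, (((k.1 : ℕ) : ℝ) ^ 2 + ((k.2 : ℕ) : ℝ) ^ 2)⁻¹ :=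
        Finset.sum_le_sum fun k _ => hterm k
    _ = ∑ i ∈ Finset.range N, ∑ j ∈ Finset.range N, (((i : ℝ) ^ 2 + (j : ℝ) ^ 2))⁻¹ := by
        rw [Fintype.sum_prod_type, ← Fin.sum_univ_eq_sum_range
          (fun i => ∑ j ∈ Finset.range N, (((i : ℝ) ^ 2 + (j : ℝ) ^ 2))⁻¹)]
        exact Finset.sum_congr rfl fun i _ =>
          Fin.sum_univ_eq_sum_range (fun j : ℕ => ((((i : ℕ) : ℝ) ^ 2 + (j : ℝ) ^ 2))⁻¹) N
    _ ≤ _ := by rw [hlog]; linarith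

/-- Decomposition of an inner product into its mean part and its part along the differences. -/
lemma sum_mul_eq_mode_add_flow {N : ℕ} [NeZero N] (ε h : Fin N × Fin N → ℝ) :
    ∑ v, ε v * h v = (∑ v, gridMode N 0 v * ε v) * (∑ v, gridMode N 0 v * h v) +
      ∑ q, gridDiff h q * ∑ v, gridFlow N q v * ε v := by
  have h1 : ∑ v, ε v * h v =
      ∑ k, (∑ v, gridMode N k v * ε v) * (∑ v, gridMode N k v * h v) := by
    calc _ = ∑ v, ∑ k, ε v * (gridMode N k v * ∑ w, gridMode N k w * h w) := by
          refine Finset.sum_congr rfl fun v _ => ?_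
          rw [← Finset.mul_sum, ← gridMode_expansion]
      _ = _ := by
          rw [Finset.sum_comm]
          refine Finset.sum_congr rfl fun k _ => ?_
          rw [Finset.sum_mul]
          exact Finset.sum_congr rfl fun v _ => by ring
  have h2 : ∀ q, ∑ v, gridFlow N q v * ε v = ∑ k, (gridEigenvalue N k)⁻¹ *
      gridDiff (gridMode N k) q * ∑ v, gridMode N k v * ε v := by
    intro q
    simp_rw [gridFlow, Finset.sum_mul, Finset.mul_sum]
    rw [Finset.sum_comm]
    exact Finset.sum_congr rfl fun k _ => Finset.sum_congr rfl fun v _ => by ring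
  have h3 : ∑ q, gridDiff h q * ∑ v, gridFlow N q v * ε v =
      ∑ k, (gridEigenvalue N k)⁻¹ * (gridEigenvalue N k * ∑ v, gridMode N k v * h v) *
        ∑ v, gridMode N k v * ε v := by
    simp_rw [h2, Finset.mul_sum (Finset.univ : Finset (Fin N × Fin N)) _ (gridDiff h _)]
    rw [Finset.sum_comm]
    refine Finset.sum_congr rfl fun k _ => ?_
    rw [← gridMode_laplacian, mul_assoc, Finset.sum_mul (Finset.univ : Finset (Bool × _)),
      Finset.mul_sum (Finset.univ : Finset (Bool × _))]
    exact Finset.sum_congr rfl fun q _ => by ring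
  rw [h1, h3, ← Finset.add_sum_erase _
      (fun k => (∑ v, gridMode N k v * ε v) * (∑ v, gridMode N k v * h v))
      (Finset.mem_univ (0 : Fin N × Fin N)),
    ← Finset.add_sum_erase _ (fun k => (gridEigenvalue N k)⁻¹ *
        (gridEigenvalue N k * ∑ v, gridMode N k v * h v) * ∑ v, gridMode N k v * ε v)
      (Finset.mem_univ (0 : Fin N × Fin N)), gridEigenvalue_zero]
  simp only [mul_zero, zero_mul, zero_add]
  congr 1
  refine Finset.sum_congr rfl fun k hk => ?_
  rw [inv_mul_cancel_left₀ (gridEigenvalue_pos (Finset.ne_of_mem_erase hk)).ne', mul_comm]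

lemma pathNext_val_of_ne {N : ℕ} {a : Fin N} (h : pathNext a ≠ a) :
    (pathNext a : ℕ) = a + 1 := by
  unfold pathNext at *
  split_ifs at * <;> simp_all

lemma pathNext_eq_of_val {N : ℕ} {a b : Fin N} (h : (a : ℕ) + 1 = b) : pathNext a = b := by
  have hb := b.2
  rw [← h] at hb
  exact Fin.ext (by simp [pathNext, h])

lemma gridStep_sum {N : ℕ} {d : Bool} {v : Fin N × Fin N} (h : gridStep d v ≠ v) :
    ((gridStep d v).1 : ℕ) + (gridStep d v).2 = v.1 + v.2 + 1 := by
  cases d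
  · have : pathNext v.2 ≠ v.2 := fun h' => h (Prod.ext rfl h')
    simp only [gridStep, pathNext_val_of_ne this]
    omega
  · have : pathNext v.1 ≠ v.1 := fun h' => h (Prod.ext h' rfl)
    simp only [gridStep, pathNext_val_of_ne this]
    omega

lemma gridStep_direction {N : ℕ} {d d' : Bool} {v : Fin N × Fin N} (h : gridStep d v ≠ v)
    (hd : gridStep d v = gridStep d' v) : d = d' := by
  cases d <;> cases d' <;> try rfl
  · exact (h (Prod.ext rfl (congrArg Prod.snd hd :))).elim
  · exact (h (Prod.ext (congrArg Prod.fst hd :) rfl)).elim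

lemma gridGraph2_adj_iff {N : ℕ} (i j : Fin N × Fin N) :
    (gridGraph2 N).Adj i j ↔ i ≠ j ∧ ((∃ d, gridStep d i = j) ∨ ∃ d, gridStep d j = i) := by
  have key : ∀ i j : Fin N × Fin N, i ≠ j → (((i.1 = j.1 ∧ (i.2 : ℕ) + 1 = (j.2 : ℕ)) ∨
      (i.2 = j.2 ∧ (i.1 : ℕ) + 1 = (j.1 : ℕ))) ↔ ∃ d, gridStep d i = j) := by
    intro i j hij
    rw [Bool.exists_bool]
    constructor
    · rintro (⟨h1, h2⟩ | ⟨h1, h2⟩)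
      · exact Or.inl (Prod.ext h1 (pathNext_eq_of_val h2))
      · exact Or.inr (Prod.ext (pathNext_eq_of_val h2) h1)
    · rintro (rfl | rfl)
      · refine Or.inl ⟨rfl, (pathNext_val_of_ne fun h => hij ?_).symm⟩
        exact Prod.ext rfl h.symm
      · refine Or.inr ⟨rfl, (pathNext_val_of_ne fun h => hij ?_).symm⟩
        exact Prod.ext h.symm rfl
  rw [gridGraph2, SimpleGraph.fromRel_adj]
  refine and_congr_right fun hij => ?_
  rw [key i j hij, key j i (Ne.symm hij)]

lemma IsIncidence.eq_of_row {V E : Type*} {G : SimpleGraph V} {D : Matrix E V ℝ}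
    (hD : IsIncidence G D) {e : E} {i j i' j' : V} (hi : D e i = 1) (hj : D e j = -1)
    (hi' : D e i' = 1) (hj' : D e j' = -1) : i = i' ∧ j = j' := by
  obtain ⟨p, n, -, hp, hn, h0⟩ := hD.1 e
  have hpos : ∀ k, D e k = 1 → k = p := by
    intro k hk
    by_contra hkp
    by_cases hkn : k = n
    · subst hkn; linarith
    · linarith [h0 k hkp hkn]
  have hneg : ∀ k, D e k = -1 → k = n := by
    intro k hk
    by_contra hkn
    by_cases hkp : k = p
    · subst hkp; linarith
    · linarith [h0 k hkp hkn]
  exact ⟨(hpos _ hi).trans (hpos _ hi').symm, (hneg _ hj).trans (hneg _ hj').symm⟩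

lemma IsIncidence.mulVec_eq {V E : Type*} [Fintype V] {G : SimpleGraph V} {D : Matrix E V ℝ}
    (hD : IsIncidence G D) {e : E} {i j : V} (hi : D e i = 1) (hj : D e j = -1) (h : V → ℝ) :
    D.mulVec h e = h i - h j := by
  obtain ⟨p, n, -, hp, hn, h0⟩ := hD.1 e
  obtain ⟨rfl, rfl⟩ := hD.eq_of_row hi hj hp hn
  have hij : i ≠ j := by rintro rfl; linarith
  rw [Matrix.mulVec, dotProduct, Fintype.sum_eq_add i j hij
    (fun k hk => by rw [h0 k hk.1 hk.2, zero_mul]), hi, hj]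
  ring

/-- The total variation over the rows of an incidence matrix is the sum of the absolute forward
differences. -/
lemma sum_abs_incidence {N : ℕ} {E : Type*} [Fintype E] {D : Matrix E (Fin N × Fin N) ℝ}
    (hD : IsIncidence (gridGraph2 N) D) (h : Fin N × Fin N → ℝ) :
    ∑ e, |D.mulVec h e| = ∑ q, |gridDiff h q| := by
  classical
  have hE : ∀ q : Bool × (Fin N × Fin N), gridStep q.1 q.2 ≠ q.2 →
      ∃! e : E, (D e q.2 = 1 ∧ D e (gridStep q.1 q.2) = -1) ∨
        (D e q.2 = -1 ∧ D e (gridStep q.1 q.2) = 1) := fun q hq =>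
    hD.2 _ _ ((gridGraph2_adj_iff _ _).2 ⟨hq.symm, Or.inl ⟨q.1, rfl⟩⟩)
  have hmoved : ∑ q, |gridDiff h q| =
      ∑ q ∈ Finset.univ.filter fun q : Bool × (Fin N × Fin N) => gridStep q.1 q.2 ≠ q.2,
        |gridDiff h q| := by
    rw [Finset.sum_filter_of_ne]
    intro q _ hq hq'
    exact hq (by simp [gridDiff, hq'])
  rw [hmoved]
  symm
  refine Finset.sum_bij (fun q hq => (hE q (Finset.mem_filter.1 hq).2).choose)
    (fun _ _ => Finset.mem_univ _) ?_ ?_ ?_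
  · intro q hq q' hq' heq
    have hm := (Finset.mem_filter.1 hq).2
    have hm' := (Finset.mem_filter.1 hq').2
    have hs := (hE q hm).choose_spec.1
    have hs' := (hE q' hm').choose_spec.1
    simp only at heq hs hs'
    rw [← heq] at hs'
    have hsame : q.2 = q'.2 → gridStep q.1 q.2 = gridStep q'.1 q'.2 → q = q' := by
      intro h1 h2
      rw [← h1] at h2
      exact Prod.ext (gridStep_direction hm h2) h1
    have hopp : q.2 = gridStep q'.1 q'.2 → gridStep q.1 q.2 = q'.2 → q = q' := by
      intro h1 h2
      have e1 := gridStep_sum hm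
      have e2 := gridStep_sum hm'
      rw [h2] at e1
      rw [← h1] at e2
      omega
    rcases hs with ⟨ha, hb⟩ | ⟨ha, hb⟩ <;> rcases hs' with ⟨ha', hb'⟩ | ⟨ha', hb'⟩
    · exact hsame (hD.eq_of_row ha hb ha' hb').1 (hD.eq_of_row ha hb ha' hb').2
    · exact hopp (hD.eq_of_row ha hb hb' ha').1 (hD.eq_of_row ha hb hb' ha').2
    · exact hopp (hD.eq_of_row hb ha ha' hb').2 (hD.eq_of_row hb ha ha' hb').1
    · exact hsame (hD.eq_of_row hb ha hb' ha').2 (hD.eq_of_row hb ha hb' ha').1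
  · intro e _
    obtain ⟨i, j, hij, hi, hj, -⟩ := hD.1 e
    obtain ⟨hne, ⟨d, hd⟩ | ⟨d, hd⟩⟩ := (gridGraph2_adj_iff _ _).1 hij
    · have hm : gridStep d i ≠ i := by rw [hd]; exact hne.symm
      refine ⟨(d, i), by simpa using hm, ?_⟩
      exact (hE (d, i) hm).unique (hE (d, i) hm).choose_spec.1
        (Or.inl ⟨hi, by rw [hd]; exact hj⟩)
    · have hm : gridStep d j ≠ j := by rw [hd]; exact hne
      refine ⟨(d, j), by simpa using hm, ?_⟩
      exact (hE (d, j) hm).unique (hE (d, j) hm).choose_spec.1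
        (Or.inr ⟨hj, by rw [hd]; exact hi⟩)
  · intro q hq
    rcases (hE q (Finset.mem_filter.1 hq).2).choose_spec.1 with ⟨ha, hb⟩ | ⟨ha, hb⟩
    · rw [hD.mulVec_eq ha hb, abs_sub_comm]
      rfl
    · rw [hD.mulVec_eq hb ha]
      rfl

lemma sum_pathNext_sub {N : ℕ} (hN : 0 < N) (f : Fin N → ℝ) :
    ∑ a, (f (pathNext a) - f a) = f ⟨N - 1, by omega⟩ - f ⟨0, hN⟩ := by
  set g : ℕ → ℝ := fun a => f ⟨min a (N - 1), by omega⟩ with hg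
  have h : ∀ a : Fin N, f (pathNext a) - f a = g (a + 1) - g a := by
    intro a
    have ha := a.2
    have h1 : (⟨min (a : ℕ) (N - 1), by omega⟩ : Fin N) = a := Fin.ext (by simp; omega)
    have h2 : (⟨min ((a : ℕ) + 1) (N - 1), by omega⟩ : Fin N) = pathNext a := by
      apply Fin.ext
      unfold pathNext
      split_ifs <;> simp <;> omega
    simp only [hg, h1, h2]
  rw [Finset.sum_congr rfl fun a _ => h a,
    Fin.sum_univ_eq_sum_range (fun a => g (a + 1) - g a), Finset.sum_range_sub]
  simp [hg]

lemma le_pathNext {N : ℕ} (a : Fin N) : a ≤ pathNext a := by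
  unfold pathNext
  split_ifs with h
  · exact Fin.le_def.2 (Nat.le_succ _)
  · exact le_rfl

/-- The total variation of a bi-isotonic matrix. -/
lemma sum_abs_gridDiff_le_of_biIso {N : ℕ} (hN : 0 < N) {θ : Fin N × Fin N → ℝ}
    (hθ : θ ∈ biIso N) :
    ∑ q, |gridDiff θ q| ≤
      2 * N * (θ (⟨N - 1, by omega⟩, ⟨N - 1, by omega⟩) - θ (⟨0, hN⟩, ⟨0, hN⟩)) := by
  set V := θ (⟨N - 1, by omega⟩, ⟨N - 1, by omega⟩) - θ (⟨0, hN⟩, ⟨0, hN⟩) with hV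
  have hlast : ∀ a : Fin N, a ≤ ⟨N - 1, by omega⟩ := fun a => by
    have := a.2
    exact Fin.le_def.2 (by simp only; omega)
  have hfirst : ∀ a : Fin N, ⟨0, hN⟩ ≤ a := fun a => Fin.le_def.2 (Nat.zero_le _)
  have h1 : ∀ b : Fin N, ∑ a : Fin N, |gridDiff θ (true, (a, b))| ≤ V := by
    intro b
    have habs : ∀ a : Fin N, |gridDiff θ (true, (a, b))| = θ (pathNext a, b) - θ (a, b) :=
      fun a => abs_of_nonneg (sub_nonneg.2 (hθ _ _ (le_pathNext a) le_rfl))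
    rw [Finset.sum_congr rfl fun a _ => habs a, sum_pathNext_sub hN fun a => θ (a, b)]
    exact sub_le_sub (hθ _ _ le_rfl (hlast b)) (hθ _ _ le_rfl (hfirst b))
  have h2 : ∀ a : Fin N, ∑ b : Fin N, |gridDiff θ (false, (a, b))| ≤ V := by
    intro a
    have habs : ∀ b : Fin N, |gridDiff θ (false, (a, b))| = θ (a, pathNext b) - θ (a, b) :=
      fun b => abs_of_nonneg (sub_nonneg.2 (hθ _ _ le_rfl (le_pathNext b)))
    rw [Finset.sum_congr rfl fun b _ => habs b, sum_pathNext_sub hN fun b => θ (a, b)]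
    exact sub_le_sub (hθ _ _ (hlast a) le_rfl) (hθ _ _ (hfirst a) le_rfl)
  rw [Fintype.sum_prod_type, Fintype.sum_bool, Fintype.sum_prod_type_right,
    Fintype.sum_prod_type]
  calc _ ≤ ∑ _b : Fin N, V + ∑ _a : Fin N, V :=
        add_le_add (Finset.sum_le_sum fun b _ => h1 b) (Finset.sum_le_sum fun a _ => h2 a)
    _ = 2 * N * V := by simp; ring

/-- First-order optimality of a TV denoiser. -/
lemma IsTVDenoiser.variational {V E : Type*} [Fintype V] [Nonempty V] [Fintype E]
    {D : Matrix E V ℝ} {lam : ℝ} (hlam : 0 ≤ lam) {y θhat : V → ℝ}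
    (h : IsTVDenoiser D lam y θhat) (θ : V → ℝ) :
    2 * ∑ i, (θhat i - y i) * (θhat i - θ i) ≤
      Fintype.card V * lam * (∑ e, |D.mulVec θ e| - ∑ e, |D.mulVec θhat e|) := by
  have hn : (0 : ℝ) < Fintype.card V := by exact_mod_cast Fintype.card_pos
  set n : ℝ := (Fintype.card V : ℝ)
  set H := ∑ i, (θhat i - θ i) ^ 2
  set P := ∑ i, (θhat i - y i) * (θhat i - θ i)
  set T := ∑ e, |D.mulVec θ e|
  set That := ∑ e, |D.mulVec θhat e|
  have hH : 0 ≤ H := Finset.sum_nonneg fun i _ => sq_nonneg _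
  have key : ∀ s : ℝ, 0 < s → s ≤ 1 → 2 * P ≤ n * lam * (T - That) + s * H := by
    intro s hs hs1
    have hs' := h ((1 - s) • θhat + s • θ)
    have hquad : ∑ i, (((1 - s) • θhat + s • θ) i - y i) ^ 2 =
        ∑ i, (θhat i - y i) ^ 2 - 2 * s * P + s ^ 2 * H := by
      simp only [P, H, Finset.mul_sum, ← Finset.sum_sub_distrib, ← Finset.sum_add_distrib]
      refine Finset.sum_congr rfl fun i _ => ?_
      simp only [Pi.add_apply, Pi.smul_apply, smul_eq_mul]
      ring
    have htv : ∑ e, |D.mulVec ((1 - s) • θhat + s • θ) e| ≤ (1 - s) * That + s * T := by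
      simp only [T, That, Finset.mul_sum, ← Finset.sum_add_distrib]
      refine Finset.sum_le_sum fun e _ => ?_
      rw [Matrix.mulVec_add, Matrix.mulVec_smul, Matrix.mulVec_smul, Pi.add_apply, Pi.smul_apply,
        Pi.smul_apply, smul_eq_mul, smul_eq_mul]
      refine (abs_add_le _ _).trans ?_
      rw [abs_mul, abs_mul, abs_of_pos hs, abs_of_nonneg (sub_nonneg.2 hs1)]
    rw [hquad] at hs'
    have h1 := mul_le_mul_of_nonneg_left htv hlam
    have h2 : 0 ≤ 1 / n * (-(2 * s * P) + s ^ 2 * H) + lam * (s * (T - That)) := by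
      linarith
    have h3 := mul_nonneg (div_nonneg hn.le hs.le) h2
    have h4 : n / s * (1 / n * (-(2 * s * P) + s ^ 2 * H) + lam * (s * (T - That))) =
        -(2 * P) + s * H + n * lam * (T - That) := by
      field_simp
    linarith
  refine le_of_forall_pos_le_add fun η hη => ?_
  have hs0 : 0 < min 1 (η / (H + 1)) := lt_min one_pos (by positivity)
  refine (key _ hs0 (min_le_left _ _)).trans ?_
  have : min 1 (η / (H + 1)) * H ≤ η := by
    calc _ ≤ η / (H + 1) * H := by
          gcongr
          exact min_le_right _ _
      _ ≤ η / (H + 1) * (H + 1) := by gcongr; linarith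
      _ = η := by field_simp
  linarith

lemma sum_gridMode_sq {N : ℕ} (k : Fin N × Fin N) : ∑ v, gridMode N k v ^ 2 = 1 := by
  simpa [sq] using gridMode_inner k k

/-- The oracle inequality on the event where the noise is controlled. -/
lemma IsTVDenoiser.oracle {N : ℕ} [NeZero N] {E : Type*} [Fintype E]
    {D : Matrix E (Fin N × Fin N) ℝ} (hD : IsIncidence (gridGraph2 N) D) {lam t : ℝ}
    (ht : 0 ≤ t) (hlam : (N : ℝ) ^ 2 * lam = 2 * t) {θstar ε θhat : Fin N × Fin N → ℝ}
    (h : IsTVDenoiser D lam (fun i => θstar i + ε i) θhat)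
    (hflow : ∀ q, |∑ v, gridFlow N q v * ε v| ≤ t) (θ : Fin N × Fin N → ℝ) :
    ∑ i, (θhat i - θstar i) ^ 2 ≤ ∑ i, (θ i - θstar i) ^ 2 +
      (∑ v, gridMode N 0 v * ε v) ^ 2 + 4 * t * ∑ q, |gridDiff θ q| := by
  have hN : (0 : ℝ) < N := by exact_mod_cast Nat.pos_of_neZero N
  have hlam0 : 0 ≤ lam := by
    by_contra! hneg
    have := mul_neg_of_pos_of_neg (by positivity : (0 : ℝ) < (N : ℝ) ^ 2) hneg
    linarith
  have hvar := h.variational hlam0 θ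
  have hcard : (Fintype.card (Fin N × Fin N) : ℝ) = (N : ℝ) ^ 2 := by
    simp [sq]
  rw [hcard, hlam, sum_abs_incidence hD, sum_abs_incidence hD] at hvar
  have hdec := sum_mul_eq_mode_add_flow ε (fun v => θhat v - θ v)
  set X := ∑ v, gridMode N 0 v * ε v
  set Y := ∑ v, gridMode N 0 v * (θhat v - θ v)
  set T := ∑ q, |gridDiff θ q|
  set That := ∑ q, |gridDiff θhat q|
  have hY : Y ^ 2 ≤ ∑ v, (θhat v - θ v) ^ 2 := by
    have := Finset.sum_mul_sq_le_sq_mul_sq Finset.univ (gridMode N 0) fun v => θhat v - θ v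
    rwa [sum_gridMode_sq, one_mul] at this
  have hR : ∑ q, gridDiff (fun v => θhat v - θ v) q * ∑ v, gridFlow N q v * ε v ≤
      t * (T + That) := by
    simp only [T, That, ← Finset.sum_add_distrib, Finset.mul_sum Finset.univ _ t]
    refine Finset.sum_le_sum fun q _ => ?_
    have hdiff : |gridDiff (fun v => θhat v - θ v) q| ≤ |gridDiff θ q| + |gridDiff θhat q| := by
      have : gridDiff (fun v => θhat v - θ v) q = gridDiff θhat q - gridDiff θ q := by
        simp only [gridDiff]; ring
      rw [this, add_comm]
      exact abs_sub _ _
    calc _ ≤ |gridDiff (fun v => θhat v - θ v) q * ∑ v, gridFlow N q v * ε v| := le_abs_self _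
      _ = |gridDiff (fun v => θhat v - θ v) q| * |∑ v, gridFlow N q v * ε v| := abs_mul _ _
      _ ≤ (|gridDiff θ q| + |gridDiff θhat q|) * t :=
          mul_le_mul hdiff (hflow q) (abs_nonneg _) (by positivity)
      _ = _ := mul_comm _ _
  have hpol : 2 * ∑ i, (θhat i - (θstar i + ε i)) * (θhat i - θ i) =
      ∑ i, (θhat i - θstar i) ^ 2 + ∑ i, (θhat i - θ i) ^ 2 - ∑ i, (θ i - θstar i) ^ 2 -
        2 * ∑ i, ε i * (θhat i - θ i) := by
    simp only [Finset.mul_sum, ← Finset.sum_sub_distrib, ← Finset.sum_add_distrib]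
    exact Finset.sum_congr rfl fun i _ => by ring
  nlinarith [sq_nonneg (X - Y)]

lemma exp_neg_two_mul_log {x : ℝ} (hx : 0 < x) : Real.exp (-(2 * Real.log x)) = (x ^ 2)⁻¹ := by
  rw [Real.exp_neg, two_mul, Real.exp_add, Real.exp_log hx, sq]

/-- The mean of the noise is controlled with high probability. -/
lemma noise_mode_tail {N : ℕ} (k : Fin N × Fin N) {σ δ : ℝ} (hσ : 0 < σ) (hδ : 0 < δ)
    (hδ1 : δ < 1) :
    noise (Fin N × Fin N) σ {ε | 2 * σ * Real.sqrt (Real.log (Real.exp 1 / δ)) ≤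
      |∑ v, gridMode N k v * ε v|} ≤ ENNReal.ofReal δ := by
  have he : (2 : ℝ) ≤ Real.exp 1 := by linarith [Real.add_one_le_exp (1 : ℝ)]
  have hlog : 0 ≤ Real.log (Real.exp 1 / δ) := by
    apply Real.log_nonneg
    rw [le_div_iff₀ hδ]
    linarith
  refine (noise_linear_tail σ (gridMode N k) (K := σ ^ 2) (by positivity)
    (by rw [sum_gridMode_sq, mul_one]) (by positivity)).trans ?_
  apply ENNReal.ofReal_le_ofReal
  have hexp : -(2 * σ * Real.sqrt (Real.log (Real.exp 1 / δ))) ^ 2 / (2 * σ ^ 2) =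
      -(2 * Real.log (Real.exp 1 / δ)) := by
    rw [mul_pow, Real.sq_sqrt hlog]
    field_simp
  rw [hexp, exp_neg_two_mul_log (by positivity), div_pow, inv_div]
  rw [mul_div_assoc', div_le_iff₀ (by positivity)]
  have he2 : 4 ≤ Real.exp 1 ^ 2 := by nlinarith
  nlinarith [mul_pos hδ hδ]

/-- All flow functionals of the noise are controlled simultaneously with high probability. -/
lemma noise_flow_tail {N : ℕ} (hN : 2 ≤ N) {σ δ : ℝ} (hσ : 0 < σ) (hδ : 0 < δ) (hδ1 : δ < 1) :
    noise (Fin N × Fin N) σ (⋃ q, {ε | 4 * σ * Real.sqrt (Real.log ((N : ℝ) ^ 2) *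
        Real.log (Real.exp 1 * (N : ℝ) ^ 2 / δ)) ≤ |∑ v, gridFlow N q v * ε v|}) ≤
      ENNReal.ofReal δ := by
  have he : (2 : ℝ) ≤ Real.exp 1 := by linarith [Real.add_one_le_exp (1 : ℝ)]
  have hN' : (2 : ℝ) ≤ N := by exact_mod_cast hN
  have hN2 : (4 : ℝ) ≤ (N : ℝ) ^ 2 := by nlinarith
  have hlogN : 0 < Real.log ((N : ℝ) ^ 2) := Real.log_pos (by linarith)
  have hlog : 0 ≤ Real.log (Real.exp 1 * (N : ℝ) ^ 2 / δ) := by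
    apply Real.log_nonneg
    rw [le_div_iff₀ hδ]
    nlinarith
  have hexp : -(4 * σ * Real.sqrt (Real.log ((N : ℝ) ^ 2) *
      Real.log (Real.exp 1 * (N : ℝ) ^ 2 / δ))) ^ 2 /
        (2 * (σ ^ 2 * (4 * Real.log ((N : ℝ) ^ 2)))) =
      -(2 * Real.log (Real.exp 1 * (N : ℝ) ^ 2 / δ)) := by
    rw [mul_pow, Real.sq_sqrt (by positivity)]
    field_simp
    ring
  have hq : ∀ q : Bool × (Fin N × Fin N),
      noise (Fin N × Fin N) σ {ε | 4 * σ * Real.sqrt (Real.log ((N : ℝ) ^ 2) *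
        Real.log (Real.exp 1 * (N : ℝ) ^ 2 / δ)) ≤ |∑ v, gridFlow N q v * ε v|} ≤
      ENNReal.ofReal (δ / (2 * (N : ℝ) ^ 2)) := by
    intro q
    refine (noise_linear_tail σ (gridFlow N q) (K := σ ^ 2 * (4 * Real.log ((N : ℝ) ^ 2)))
      (by positivity) (by gcongr; exact sum_gridFlow_sq_le hN q) (by positivity)).trans ?_
    apply ENNReal.ofReal_le_ofReal
    rw [hexp, exp_neg_two_mul_log (by positivity), div_pow, inv_div, mul_div_assoc',
      div_le_div_iff₀ (by positivity) (by positivity), mul_pow]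
    have he2 : 4 ≤ Real.exp 1 ^ 2 := by nlinarith
    have hNδ : δ ≤ (N : ℝ) ^ 2 := by linarith
    calc _ = 4 * (δ * (N : ℝ) ^ 2 * δ) := by ring
      _ ≤ Real.exp 1 ^ 2 * (δ * (N : ℝ) ^ 2 * (N : ℝ) ^ 2) := by gcongr
      _ = _ := by ring
  refine (measure_iUnion_fintype_le _ _).trans ((Finset.sum_le_sum fun q _ => hq q).trans ?_)
  rw [Finset.sum_const, nsmul_eq_mul, Finset.card_univ, Fintype.card_prod, Fintype.card_prod,
    Fintype.card_bool, Fintype.card_fin, ← ENNReal.ofReal_natCast,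
    ← ENNReal.ofReal_mul (by positivity)]
  apply ENNReal.ofReal_le_ofReal
  push_cast
  apply le_of_eq
  field_simp

/-- Proposition 5.7: oracle inequality for the 2D TV
denoiser against the bi-isotonic projection `θ↑` of `θ*`, with the square
variation `D(θ↑) = (θ↑_{N,N} − θ↑_{1,1})²`. -/
theorem bi_isotonic_rate :
    ∃ c : ℝ, 0 < c ∧ ∃ C : ℝ, 0 < C ∧
      ∀ δ : ℝ, 0 < δ → δ < 1 → ∀ N : ℕ, ∀ hN : 2 ≤ N, ∀ σ : ℝ, 0 < σ →
      ∀ (m : ℕ) (D : Matrix (Fin m) (Fin N × Fin N) ℝ),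
        IsIncidence (gridGraph2 N) D →
      ∀ θstar θup : Fin N × Fin N → ℝ,
        θup ∈ biIso N →
        (∀ η ∈ biIso N, ∑ i, (θup i - θstar i) ^ 2 ≤ ∑ i, (η i - θstar i) ^ 2) →
      ∀ lam : ℝ,
        lam = c * σ * Real.sqrt (Real.log ((N : ℝ) ^ 2) *
            Real.log (Real.exp 1 * (N : ℝ) ^ 2 / δ)) / (N : ℝ) ^ 2 →
        ENNReal.ofReal (1 - 2 * δ) ≤
          noise (Fin N × Fin N) σ
            {ε | ∀ θhat : Fin N × Fin N → ℝ,
              IsTVDenoiser D lam (fun i => θstar i + ε i) θhat →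
                (1 / (N : ℝ) ^ 2) * ∑ i, (θhat i - θstar i) ^ 2 ≤
                  (1 / (N : ℝ) ^ 2) * ∑ i, (θup i - θstar i) ^ 2
                  + C * σ * Real.sqrt (Real.log ((N : ℝ) ^ 2)
                        * Real.log ((N : ℝ) ^ 2 / δ) / (N : ℝ) ^ 2)
                    * Real.sqrt ((θup (⟨N - 1, by omega⟩, ⟨N - 1, by omega⟩)
                        - θup (⟨0, by omega⟩, ⟨0, by omega⟩)) ^ 2)
                  + C * σ ^ 2 / (N : ℝ) ^ 2 * Real.log (Real.exp 1 / δ)} := by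
  refine ⟨8, by norm_num, 64, by norm_num, ?_⟩
  intro δ hδ hδ1 N hN σ hσ m D hD θstar θup hup _ lam hlam
  have : NeZero N := ⟨by omega⟩
  have hprob : IsProbabilityMeasure (noise (Fin N × Fin N) σ) := by unfold noise; infer_instance
  have hN' : (2 : ℝ) ≤ N := by exact_mod_cast hN
  have hN2 : (4 : ℝ) ≤ (N : ℝ) ^ 2 := by nlinarith
  have hlogN : 1 ≤ Real.log ((N : ℝ) ^ 2) := by
    rw [Real.log_pow]
    have := Real.log_two_gt_d9
    have := Real.log_le_log (by norm_num) hN'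
    push_cast
    linarith
  have hlogδ : Real.log ((N : ℝ) ^ 2) ≤ Real.log ((N : ℝ) ^ 2 / δ) := by
    refine Real.log_le_log (by positivity) ?_
    rw [le_div_iff₀ hδ]
    nlinarith
  have hlogsplit : Real.log (Real.exp 1 * (N : ℝ) ^ 2 / δ) =
      1 + Real.log ((N : ℝ) ^ 2 / δ) := by
    rw [mul_div_assoc, Real.log_mul (Real.exp_pos 1).ne' (by positivity), Real.log_exp]
  have hloge : 0 ≤ Real.log (Real.exp 1 / δ) := by
    apply Real.log_nonneg
    rw [le_div_iff₀ hδ]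
    linarith [Real.add_one_le_exp (1 : ℝ)]
  set t₀ := 2 * σ * Real.sqrt (Real.log (Real.exp 1 / δ)) with ht₀
  set t := 4 * σ * Real.sqrt (Real.log ((N : ℝ) ^ 2) *
    Real.log (Real.exp 1 * (N : ℝ) ^ 2 / δ)) with ht
  set A := {ε : Fin N × Fin N → ℝ | t₀ ≤ |∑ v, gridMode N 0 v * ε v|} with hA
  set B := ⋃ q, {ε : Fin N × Fin N → ℝ | t ≤ |∑ v, gridFlow N q v * ε v|} with hB
  have hAB : noise (Fin N × Fin N) σ (A ∪ B) ≤ ENNReal.ofReal (2 * δ) := by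
    refine (measure_union_le _ _).trans ((add_le_add (noise_mode_tail 0 hσ hδ hδ1)
      (noise_flow_tail hN hσ hδ hδ1)).trans ?_)
    rw [← ENNReal.ofReal_add hδ.le hδ.le, two_mul]
  have hgood : ENNReal.ofReal (1 - 2 * δ) ≤ noise (Fin N × Fin N) σ (A ∪ B)ᶜ := by
    rw [ENNReal.ofReal_sub _ (by positivity), ENNReal.ofReal_one, tsub_le_iff_right]
    calc (1 : ENNReal) = noise (Fin N × Fin N) σ ((A ∪ B)ᶜ ∪ (A ∪ B)) := by
          rw [Set.compl_union_self, measure_univ]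
      _ ≤ _ := measure_union_le _ _
      _ ≤ _ := by gcongr
  refine hgood.trans (measure_mono fun ε hε θhat hθ => ?_)
  simp only [hA, hB, Set.mem_compl_iff, Set.mem_union, Set.mem_ofPred_eq, Set.mem_iUnion, not_or,
    not_exists, not_le] at hε
  have hlam' : (N : ℝ) ^ 2 * lam = 2 * t := by
    rw [hlam, ht]
    field_simp
    ring
  have horacle := hθ.oracle hD (by positivity) hlam' (fun q => (hε.2 q).le) θup
  have hmode : (∑ v, gridMode N 0 v * ε v) ^ 2 ≤ 4 * σ ^ 2 * Real.log (Real.exp 1 / δ) := by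
    calc _ = |∑ v, gridMode N 0 v * ε v| ^ 2 := (sq_abs _).symm
      _ ≤ t₀ ^ 2 := by gcongr; exact hε.1.le
      _ = _ := by rw [ht₀, mul_pow, Real.sq_sqrt hloge]; ring
  have htv := sum_abs_gridDiff_le_of_biIso (by omega) hup
  have hVnonneg : 0 ≤ θup (⟨N - 1, by omega⟩, ⟨N - 1, by omega⟩) -
      θup (⟨0, by omega⟩, ⟨0, by omega⟩) :=
    sub_nonneg.2 (hup _ _ (Fin.le_def.2 (Nat.zero_le _)) (Fin.le_def.2 (Nat.zero_le _)))
  set V := θup (⟨N - 1, by omega⟩, ⟨N - 1, by omega⟩) - θup (⟨0, by omega⟩, ⟨0, by omega⟩)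
  have ht' : t ≤ 8 * σ * Real.sqrt (Real.log ((N : ℝ) ^ 2) * Real.log ((N : ℝ) ^ 2 / δ)) := by
    have hle : Real.log ((N : ℝ) ^ 2) * Real.log (Real.exp 1 * (N : ℝ) ^ 2 / δ) ≤
        2 ^ 2 * (Real.log ((N : ℝ) ^ 2) * Real.log ((N : ℝ) ^ 2 / δ)) := by
      rw [hlogsplit]
      nlinarith
    calc t ≤ 4 * σ * Real.sqrt (2 ^ 2 *
          (Real.log ((N : ℝ) ^ 2) * Real.log ((N : ℝ) ^ 2 / δ))) := by
          rw [ht]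
          gcongr
      _ = _ := by
          rw [Real.sqrt_mul (by positivity), Real.sqrt_sq (by norm_num)]
          ring
  rw [Real.sqrt_sq hVnonneg, Real.sqrt_div' _ (by positivity), Real.sqrt_sq (by positivity)]
  set R := Real.sqrt (Real.log ((N : ℝ) ^ 2) * Real.log ((N : ℝ) ^ 2 / δ))
  have htotal : ∑ i, (θhat i - θstar i) ^ 2 ≤ ∑ i, (θup i - θstar i) ^ 2 +
      64 * σ ^ 2 * Real.log (Real.exp 1 / δ) + 4 * (8 * σ * R) * (2 * N * V) := by
    have h1 : 4 * t * ∑ q, |gridDiff θup q| ≤ 4 * (8 * σ * R) * (2 * N * V) := by gcongr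
    have h2 : 0 ≤ σ ^ 2 * Real.log (Real.exp 1 / δ) := by positivity
    linarith
  calc _ ≤ 1 / (N : ℝ) ^ 2 * (∑ i, (θup i - θstar i) ^ 2 +
      64 * σ ^ 2 * Real.log (Real.exp 1 / δ) + 4 * (8 * σ * R) * (2 * N * V)) := by gcongr
    _ = _ := by
      field_simp
      ring
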